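/- arXiv:2205.08829 — 3 statements merged into one kernel-verified Lean document; each statement's English description precedes it below -/
import Mathlib

section
/- Let c > 0, let λ : ℝ → ℝ be continuous with antiderivative Λ (Λ' = λ), and let f₀, f₁, f₂ : ℝ³ → ℝ be continuously differentiable functions of (t,u,v) satisfying: ∂f₀/∂t = −c ∂f₀/∂u + (λ(t)/4)(f₁+f₂−4f₀); ∂f₁/∂t = (c/2) ∂f₁/∂u − (√3 c/2) ∂f₁/∂v + (λ(t)/4)(f₀+f₂−4f₁); ∂f₂/∂t = (c/2) ∂f₂/∂u + (√3 c/2) ∂f₂/∂v + (λ(t)/4)(f₀+f₁−4f₂). Define qᵢ(t,u,v) = 2 e^{Λ(t)/2} fᵢ(t,u,v) for i ∈ {0,1,2}. Then the qᵢ satisfy: ∂q₀/∂t = −c ∂q₀/∂u + (λ(t)/4)(q₁+q₂−2q₀); ∂q₁/∂t = (c/2) ∂q₁/∂u − (√3 c/2) ∂q₁/∂v + (λ(t)/4)(q₀+q₂−2q₁); ∂q₂/∂t = (c/2) ∂q₂/∂u + (√3 c/2) ∂q₂/∂v + (λ(t)/4)(q₀+q₁−2q₂). -/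
/-- Partial derivative in the first (time) variable of a function of three real variables. -/
noncomputable def pt3 (f : ℝ → ℝ → ℝ → ℝ) : ℝ → ℝ → ℝ → ℝ :=
  fun t u v => deriv (fun s => f s u v) t

/-- Partial derivative in the second (u) variable. -/
noncomputable def pu3 (f : ℝ → ℝ → ℝ → ℝ) : ℝ → ℝ → ℝ → ℝ :=
  fun t u v => deriv (fun s => f t s v) u

/-- Partial derivative in the third (v) variable. -/
noncomputable def pv3 (f : ℝ → ℝ → ℝ → ℝ) : ℝ → ℝ → ℝ → ℝ :=
  fun t u v => deriv (fun s => f t u s) v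

/-- Time derivative of `f` rescaled by `2 e^{Λ(t)/2}`: the factor contributes `λ(t)/2`. -/
theorem pt3_two_mul_exp_half_mul {lam Lam : ℝ → ℝ} {f : ℝ → ℝ → ℝ → ℝ}
    (hLam : ∀ t, HasDerivAt Lam (lam t) t)
    (hf : Differentiable ℝ (fun p : ℝ × ℝ × ℝ => f p.1 p.2.1 p.2.2)) (t u v : ℝ) :
    pt3 (fun t u v => 2 * Real.exp (Lam t / 2) * f t u v) t u v =
      2 * Real.exp (Lam t / 2) * (pt3 f t u v + lam t / 2 * f t u v) := by
  have hd : Differentiable ℝ (fun s => f s u v) :=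
    hf.comp (g := fun p : ℝ × ℝ × ℝ => f p.1 p.2.1 p.2.2) (f := fun s : ℝ => (s, u, v))
      (by fun_prop)
  have h := (((hLam t).div_const 2).exp.const_mul 2).mul (hd t).hasDerivAt
  refine h.deriv.trans ?_
  simp only [pt3]
  ring

theorem pu3_mul_left (g : ℝ → ℝ) (f : ℝ → ℝ → ℝ → ℝ) (t u v : ℝ) :
    pu3 (fun t u v => g t * f t u v) t u v = g t * pu3 f t u v :=
  deriv_const_mul_field (g t)

theorem pv3_mul_left (g : ℝ → ℝ) (f : ℝ → ℝ → ℝ → ℝ) (t u v : ℝ) :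
    pv3 (fun t u v => g t * f t u v) t u v = g t * pv3 f t u v :=
  deriv_const_mul_field (g t)

theorem motion_on_face_system
    (c : ℝ) (hc : 0 < c)
    (lam Lam : ℝ → ℝ) (hlam : Continuous lam)
    (hLam : ∀ t, HasDerivAt Lam (lam t) t)
    (f0 f1 f2 : ℝ → ℝ → ℝ → ℝ)
    (hf0 : ContDiff ℝ 1 (fun p : ℝ × ℝ × ℝ => f0 p.1 p.2.1 p.2.2))
    (hf1 : ContDiff ℝ 1 (fun p : ℝ × ℝ × ℝ => f1 p.1 p.2.1 p.2.2))
    (hf2 : ContDiff ℝ 1 (fun p : ℝ × ℝ × ℝ => f2 p.1 p.2.1 p.2.2))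
    (heq0 : ∀ t u v, pt3 f0 t u v =
      -c * pu3 f0 t u v + (lam t / 4) * (f1 t u v + f2 t u v - 4 * f0 t u v))
    (heq1 : ∀ t u v, pt3 f1 t u v =
      (c / 2) * pu3 f1 t u v - (Real.sqrt 3 * c / 2) * pv3 f1 t u v
        + (lam t / 4) * (f0 t u v + f2 t u v - 4 * f1 t u v))
    (heq2 : ∀ t u v, pt3 f2 t u v =
      (c / 2) * pu3 f2 t u v + (Real.sqrt 3 * c / 2) * pv3 f2 t u v
        + (lam t / 4) * (f0 t u v + f1 t u v - 4 * f2 t u v))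
    (q0 q1 q2 : ℝ → ℝ → ℝ → ℝ)
    (hq0 : q0 = fun t u v => 2 * Real.exp (Lam t / 2) * f0 t u v)
    (hq1 : q1 = fun t u v => 2 * Real.exp (Lam t / 2) * f1 t u v)
    (hq2 : q2 = fun t u v => 2 * Real.exp (Lam t / 2) * f2 t u v) :
    (∀ t u v, pt3 q0 t u v =
      -c * pu3 q0 t u v + (lam t / 4) * (q1 t u v + q2 t u v - 2 * q0 t u v)) ∧
    (∀ t u v, pt3 q1 t u v =
      (c / 2) * pu3 q1 t u v - (Real.sqrt 3 * c / 2) * pv3 q1 t u v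
        + (lam t / 4) * (q0 t u v + q2 t u v - 2 * q1 t u v)) ∧
    (∀ t u v, pt3 q2 t u v =
      (c / 2) * pu3 q2 t u v + (Real.sqrt 3 * c / 2) * pv3 q2 t u v
        + (lam t / 4) * (q0 t u v + q1 t u v - 2 * q2 t u v)) := by
  subst hq0 hq1 hq2
  have hu := pu3_mul_left fun t => 2 * Real.exp (Lam t / 2)
  have hv := pv3_mul_left fun t => 2 * Real.exp (Lam t / 2)
  refine ⟨fun t u v => ?_, fun t u v => ?_, fun t u v => ?_⟩
  · rw [pt3_two_mul_exp_half_mul hLam (hf0.differentiable one_ne_zero), hu, heq0]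
    ring
  · rw [pt3_two_mul_exp_half_mul hLam (hf1.differentiable one_ne_zero), hu, hv, heq1]
    ring
  · rw [pt3_two_mul_exp_half_mul hLam (hf2.differentiable one_ne_zero), hu, hv, heq2]
    ring
end

section
/- Let c > 0, let λ : ℝ → ℝ be continuously differentiable, and let f₀, f₁ : ℝ² → ℝ be twice continuously differentiable functions of (t,v) satisfying: ∂f₀/∂t = −c ∂f₀/∂v + (λ(t)/4)(f₁ − 4f₀) and ∂f₁/∂t = c ∂f₁/∂v + (λ(t)/4)(f₀ − 4f₁). Then p = f₀ + f₁ satisfies the second-order equation ∂²p/∂t² + 2λ(t) ∂p/∂t + (3/4)(λ'(t) + (5/4)λ(t)²) p = c² ∂²p/∂v². -/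
/-- Partial derivative in the first (time) variable of a function of two real variables. -/
noncomputable def pt2 (f : ℝ → ℝ → ℝ) : ℝ → ℝ → ℝ :=
  fun t v => deriv (fun u => f u v) t

/-- Partial derivative in the second (v) variable. -/
noncomputable def pv2 (f : ℝ → ℝ → ℝ) : ℝ → ℝ → ℝ :=
  fun t v => deriv (fun u => f t u) v

theorem pt2_eq_fderiv {f : ℝ → ℝ → ℝ} (hf : Differentiable ℝ (fun p : ℝ × ℝ => f p.1 p.2))
    (t v : ℝ) : pt2 f t v = fderiv ℝ (fun p : ℝ × ℝ => f p.1 p.2) (t, v) (1, 0) :=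
  ((hf (t, v)).hasFDerivAt.comp_hasDerivAt (f := fun u : ℝ => (u, v)) t
    ((hasDerivAt_id t).prodMk (hasDerivAt_const t v))).deriv

theorem pv2_eq_fderiv {f : ℝ → ℝ → ℝ} (hf : Differentiable ℝ (fun p : ℝ × ℝ => f p.1 p.2))
    (t v : ℝ) : pv2 f t v = fderiv ℝ (fun p : ℝ × ℝ => f p.1 p.2) (t, v) (0, 1) :=
  ((hf (t, v)).hasFDerivAt.comp_hasDerivAt (f := fun u : ℝ => (t, u)) v
    ((hasDerivAt_const v t).prodMk (hasDerivAt_id v))).deriv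

theorem hasDerivAt_pt2 {f : ℝ → ℝ → ℝ} (hf : Differentiable ℝ (fun p : ℝ × ℝ => f p.1 p.2))
    (t v : ℝ) : HasDerivAt (fun u => f u v) (pt2 f t v) t :=
  ((hf (t, v)).comp (f := fun u : ℝ => (u, v)) t (by fun_prop)).hasDerivAt

theorem hasDerivAt_pv2 {f : ℝ → ℝ → ℝ} (hf : Differentiable ℝ (fun p : ℝ × ℝ => f p.1 p.2))
    (t v : ℝ) : HasDerivAt (fun u => f t u) (pv2 f t v) v :=
  ((hf (t, v)).comp (f := fun u : ℝ => (t, u)) v (by fun_prop)).hasDerivAt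

theorem differentiable_pv2 {f : ℝ → ℝ → ℝ} (hf : ContDiff ℝ 2 (fun p : ℝ × ℝ => f p.1 p.2)) :
    Differentiable ℝ (fun p : ℝ × ℝ => pv2 f p.1 p.2) := by
  have hd : Differentiable ℝ (fderiv ℝ (fun p : ℝ × ℝ => f p.1 p.2)) :=
    (hf.fderiv_right (m := 1) (by norm_num)).differentiable (by norm_num)
  simp only [pv2_eq_fderiv (hf.differentiable (by norm_num))]
  exact hd.clm_apply (differentiable_const _)

/-- Mixed second partial derivatives of a `C²` function commute. -/
theorem pt2_pv2_comm {f : ℝ → ℝ → ℝ} (hf : ContDiff ℝ 2 (fun p : ℝ × ℝ => f p.1 p.2))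
    (t v : ℝ) : pt2 (pv2 f) t v = pv2 (pt2 f) t v := by
  have hF := hf.differentiable (by norm_num)
  have hd : Differentiable ℝ (fderiv ℝ (fun p : ℝ × ℝ => f p.1 p.2)) :=
    (hf.fderiv_right (m := 1) (by norm_num)).differentiable (by norm_num)
  have ht : pt2 f = fun t v => fderiv ℝ (fun p : ℝ × ℝ => f p.1 p.2) (t, v) (1, 0) :=
    funext₂ (pt2_eq_fderiv hF)
  have hv : pv2 f = fun t v => fderiv ℝ (fun p : ℝ × ℝ => f p.1 p.2) (t, v) (0, 1) :=
    funext₂ (pv2_eq_fderiv hF)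
  have key : ∀ w : ℝ × ℝ, HasFDerivAt
      (fun q : ℝ × ℝ => fderiv ℝ (fun p : ℝ × ℝ => f p.1 p.2) (q.1, q.2) w)
      ((fderiv ℝ (fderiv ℝ (fun p : ℝ × ℝ => f p.1 p.2)) (t, v)).flip w) (t, v) := fun w => by
    simpa using (hd (t, v)).hasFDerivAt.clm_apply (hasFDerivAt_const w (t, v))
  have hdw : ∀ w : ℝ × ℝ, Differentiable ℝ
      (fun q : ℝ × ℝ => fderiv ℝ (fun p : ℝ × ℝ => f p.1 p.2) (q.1, q.2) w) := fun w =>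
    hd.clm_apply (differentiable_const w)
  rw [hv, ht, pt2_eq_fderiv (hdw _), pv2_eq_fderiv (hdw _), (key _).fderiv, (key _).fderiv]
  exact hf.contDiffAt.isSymmSndFDerivAt (by simp) (1, 0) (0, 1)

theorem edge_telegraph_equation
    (c : ℝ) (hc : 0 < c)
    (lam : ℝ → ℝ) (hlam : ContDiff ℝ 1 lam)
    (f0 f1 : ℝ → ℝ → ℝ)
    (hf0 : ContDiff ℝ 2 (fun p : ℝ × ℝ => f0 p.1 p.2))
    (hf1 : ContDiff ℝ 2 (fun p : ℝ × ℝ => f1 p.1 p.2))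
    (heq0 : ∀ t v, pt2 f0 t v = -c * pv2 f0 t v + (lam t / 4) * (f1 t v - 4 * f0 t v))
    (heq1 : ∀ t v, pt2 f1 t v = c * pv2 f1 t v + (lam t / 4) * (f0 t v - 4 * f1 t v))
    (p : ℝ → ℝ → ℝ) (hp : p = fun t v => f0 t v + f1 t v) :
    ∀ t v,
      pt2 (pt2 p) t v + 2 * lam t * pt2 p t v
        + (3 / 4) * (deriv lam t + (5 / 4) * lam t ^ 2) * p t v
      = c ^ 2 * pv2 (pv2 p) t v := by
  subst hp
  intro t v
  have d0 := hf0.differentiable (by norm_num)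
  have d1 := hf1.differentiable (by norm_num)
  have hpt : pt2 (fun t v => f0 t v + f1 t v) = fun t v =>
      c * (pv2 f1 t v - pv2 f0 t v) - 3 / 4 * (lam t * (f0 t v + f1 t v)) := by
    funext t v
    have h : pt2 (fun t v => f0 t v + f1 t v) t v = pt2 f0 t v + pt2 f1 t v :=
      ((hasDerivAt_pt2 d0 t v).add (hasDerivAt_pt2 d1 t v)).deriv
    rw [h, heq0, heq1]
    ring
  have hpv : pv2 (fun t v => f0 t v + f1 t v) = fun t v => pv2 f0 t v + pv2 f1 t v := by
    funext t v
    exact ((hasDerivAt_pv2 d0 t v).add (hasDerivAt_pv2 d1 t v)).deriv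
  have e0 := differentiable_pv2 hf0
  have e1 := differentiable_pv2 hf1
  have hl : HasDerivAt lam (deriv lam t) t :=
    (hlam.differentiable (by norm_num) t).hasDerivAt
  have hptt : pt2 (fun t v =>
        c * (pv2 f1 t v - pv2 f0 t v) - 3 / 4 * (lam t * (f0 t v + f1 t v))) t v =
      c * (pt2 (pv2 f1) t v - pt2 (pv2 f0) t v) - 3 / 4 * (deriv lam t * (f0 t v + f1 t v)
        + lam t * (pt2 f0 t v + pt2 f1 t v)) :=
    ((((hasDerivAt_pt2 e1 t v).sub (hasDerivAt_pt2 e0 t v)).const_mul c).sub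
      ((hl.mul ((hasDerivAt_pt2 d0 t v).add (hasDerivAt_pt2 d1 t v))).const_mul (3 / 4))).deriv
  have hpvv : pv2 (fun t v => pv2 f0 t v + pv2 f1 t v) t v =
      pv2 (pv2 f0) t v + pv2 (pv2 f1) t v :=
    ((hasDerivAt_pv2 e0 t v).add (hasDerivAt_pv2 e1 t v)).deriv
  have hm0 : pv2 (pt2 f0) t v =
      -c * pv2 (pv2 f0) t v + lam t / 4 * (pv2 f1 t v - 4 * pv2 f0 t v) := by
    rw [funext₂ heq0]
    exact (((hasDerivAt_pv2 e0 t v).const_mul (-c)).add (((hasDerivAt_pv2 d1 t v).sub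
      ((hasDerivAt_pv2 d0 t v).const_mul 4)).const_mul (lam t / 4))).deriv
  have hm1 : pv2 (pt2 f1) t v =
      c * pv2 (pv2 f1) t v + lam t / 4 * (pv2 f0 t v - 4 * pv2 f1 t v) := by
    rw [funext₂ heq1]
    exact (((hasDerivAt_pv2 e1 t v).const_mul c).add (((hasDerivAt_pv2 d0 t v).sub
      ((hasDerivAt_pv2 d1 t v).const_mul 4)).const_mul (lam t / 4))).deriv
  rw [hpt, hpv, hptt, hpvv, pt2_pv2_comm hf0, pt2_pv2_comm hf1, hm0, hm1, heq0, heq1]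
  ring
end

section
/- Let c > 0, let λ : ℝ → ℝ be continuously differentiable with antiderivative Λ (Λ' = λ), let q : ℝ² → ℝ be twice continuously differentiable in (t,v), and define p(t,v) = (2/3) e^{−Λ(t)/2} q(t,v). Then p satisfies ∂²p/∂t² + 2λ(t) ∂p/∂t + (3/4)(λ'(t) + (5/4)λ(t)²) p = c² ∂²p/∂v² if and only if q satisfies ∂²q/∂t² + λ(t) ∂q/∂t + (1/4)(λ'(t) + (3/4)λ(t)²) q = c² ∂²q/∂v². -/
/-- Time derivative of an exponential weight `exp (-Λ / 2)` times a differentiable function. -/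
theorem pt2_exp_mul {a : ℝ} {lam Lam : ℝ → ℝ}
    (hLam : ∀ t, HasDerivAt Lam (lam t) t) {q : ℝ → ℝ → ℝ}
    (hq : ∀ t v, DifferentiableAt ℝ (fun u => q u v) t) :
    pt2 (fun t v => a * Real.exp (-Lam t / 2) * q t v) =
      fun t v => a * Real.exp (-Lam t / 2) * (pt2 q t v - lam t / 2 * q t v) := by
  funext t v
  have hE : HasDerivAt (fun u => a * Real.exp (-Lam u / 2))
      (a * (Real.exp (-Lam t / 2) * (-lam t / 2))) t :=
    ((hLam t).neg.div_const 2).exp.const_mul a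
  have h := (hE.mul (hq t v).hasDerivAt).deriv
  refine h.trans ?_
  simp only [pt2]
  ring

theorem pv2_mul_left (g : ℝ → ℝ) (q : ℝ → ℝ → ℝ) :
    pv2 (fun t v => g t * q t v) = fun t v => g t * pv2 q t v := by
  funext t v
  exact deriv_const_mul_field (g t)

theorem edge_equation_transformation
    (c : ℝ) (hc : 0 < c)
    (lam Lam : ℝ → ℝ) (hlam : ContDiff ℝ 1 lam)
    (hLam : ∀ t, HasDerivAt Lam (lam t) t)
    (q : ℝ → ℝ → ℝ)
    (hq : ContDiff ℝ 2 (fun p : ℝ × ℝ => q p.1 p.2))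
    (p : ℝ → ℝ → ℝ)
    (hp : p = fun t v => (2 / 3) * Real.exp (-Lam t / 2) * q t v) :
    (∀ t v,
      pt2 (pt2 p) t v + 2 * lam t * pt2 p t v
        + (3 / 4) * (deriv lam t + (5 / 4) * lam t ^ 2) * p t v
      = c ^ 2 * pv2 (pv2 p) t v)
    ↔
    (∀ t v,
      pt2 (pt2 q) t v + lam t * pt2 q t v
        + (1 / 4) * (deriv lam t + (3 / 4) * lam t ^ 2) * q t v
      = c ^ 2 * pv2 (pv2 q) t v) := by
  have hslice : ∀ v, ContDiff ℝ 2 (fun u => q u v) := fun v =>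
    hq.comp (contDiff_id.prodMk contDiff_const)
  have hq0 : ∀ t v, DifferentiableAt ℝ (fun u => q u v) t := fun t v =>
    (hslice v).differentiable (by norm_num) t
  have hq1 : ∀ t v, DifferentiableAt ℝ (fun u => pt2 q u v) t := fun t v =>
    ((contDiff_succ_iff_deriv (n := 1)).1 (hslice v)).2.2.differentiable (by norm_num) t
  have hlam' : ∀ t, DifferentiableAt ℝ lam t := fun t => hlam.differentiable (by norm_num) t
  have hr : ∀ t v, HasDerivAt (fun u => pt2 q u v - lam u / 2 * q u v)
      (pt2 (pt2 q) t v - (deriv lam t / 2 * q t v + lam t / 2 * pt2 q t v)) t := fun t v =>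
    (hq1 t v).hasDerivAt.sub
      (((hlam' t).hasDerivAt.div_const 2).mul (hq0 t v).hasDerivAt)
  have hr' : ∀ t v, pt2 (fun t v => pt2 q t v - lam t / 2 * q t v) t v =
      pt2 (pt2 q) t v - (deriv lam t / 2 * q t v + lam t / 2 * pt2 q t v) := fun t v =>
    (hr t v).deriv
  subst hp
  rw [pt2_exp_mul hLam hq0, pt2_exp_mul hLam fun t v => (hr t v).differentiableAt,
    pv2_mul_left, pv2_mul_left]
  simp only [hr']
  refine forall₂_congr fun t v => ?_
  have hE : (2 / 3) * Real.exp (-Lam t / 2) ≠ 0 := by positivity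
  constructor <;> intro h
  · apply mul_left_cancel₀ hE
    linear_combination h
  · linear_combination (2 / 3) * Real.exp (-Lam t / 2) * h
end
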